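/- Let β ∈ (−1/2, 1/2) and let g be a measurable function on ℝ with ∫_ℝ |g(ξ)|² |ξ|^{2β} dξ < ∞. For n ∈ ℤ set g_n = χ_{I_n} g with I_n = [−2^{n+1}, −2^n] ∪ [2^n, 2^{n+1}]. Then there is a constant C depending only on β such that Σ_{m∈ℤ} Σ_{k∈ℤ} ∫_{I_m} |(φ_k^∨ * (g_{m−1} + g_m + g_{m+1}))(ξ)|² |ξ|^{2β} dξ ≤ C ∫_ℝ |g(ξ)|² |ξ|^{2β} dξ. -/

import Mathlib

open MeasureTheory Real Set Filter Metric
open scoped FourierTransform ENNReal NNReal Topology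

noncomputable section

/-- The tent function `φ_k`, equal to `1` on `[2^k, 2^{k+1}]`, linear on
`[2^{k-1}, 2^k]` and `[2^{k+1}, 3·2^k]`, and `0` elsewhere. -/
def tent (k : ℤ) (x : ℝ) : ℝ :=
  if x ∈ Icc ((2 : ℝ) ^ k) ((2 : ℝ) ^ (k + 1)) then 1
  else if x ∈ Icc ((2 : ℝ) ^ (k - 1)) ((2 : ℝ) ^ k) then (2 : ℝ) ^ (1 - k) * x - 1
  else if x ∈ Icc ((2 : ℝ) ^ (k + 1)) (3 * (2 : ℝ) ^ k) then 3 - (2 : ℝ) ^ (-k) * x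
  else 0

/-- The set `I_n = [-2^{n+1}, -2^n] ∪ [2^n, 2^{n+1}]`. -/
def Iset (n : ℤ) : Set ℝ :=
  Icc (-(2 : ℝ) ^ (n + 1)) (-(2 : ℝ) ^ n) ∪ Icc ((2 : ℝ) ^ n) ((2 : ℝ) ^ (n + 1))

/-- Convolution on `ℝ`. -/
def convF (f g : ℝ → ℂ) (ξ : ℝ) : ℂ := ∫ η : ℝ, f (ξ - η) * g η

theorem plancherel_ae (f : ℝ → ℂ) (h1 : Integrable f) (h2 : MemLp f 2) :
    𝓕 f =ᵐ[volume] (𝓕 (h2.toLp f) : Lp (α := ℝ) ℂ 2) := by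
  have hcont : Continuous (𝓕 f) :=
    VectorFourier.fourierIntegral_continuous Real.continuous_fourierChar
      (L := innerₗ ℝ) continuous_inner h1
  apply ae_eq_of_integral_contDiff_smul_eq hcont.locallyIntegrable
    ((Lp.memLp _).locallyIntegrable (by norm_num))
  intro g hg hs
  have hs' : HasCompactSupport (fun x => (g x : ℂ)) := hs.comp_left (g := fun x : ℝ => (x : ℂ)) (by simp)
  have hg' : ContDiff ℝ (⊤ : ℕ∞) (fun x => (g x : ℂ)) := Complex.ofRealCLM.contDiff.comp hg
  set ψ : SchwartzMap ℝ ℂ := hs'.toSchwartzMap hg' with hψ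
  have hψx : ∀ x, ψ x = (g x : ℂ) := fun x => rfl
  have e := congrArg (fun T => T ψ) (Lp.fourier_toTemperedDistribution_eq (h2.toLp f))
  simp only [TemperedDistribution.fourier_apply, Lp.toTemperedDistribution_apply] at e
  have e2 := VectorFourier.integral_fourierIntegral_smul_eq_flip (L := innerₗ ℝ) (μ := volume) (ν := volume)
    (f := ψ) (g := f) Real.continuous_fourierChar continuous_inner ψ.integrable h1
  rw [flip_innerₗ] at e2
  have e3 : ∫ x, (𝓕 ψ) x • (h2.toLp f) x = ∫ x, (𝓕 ψ) x • f x := by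
    apply integral_congr_ae
    filter_upwards [h2.coeFn_toLp] with x hx
    rw [hx]
  rw [e3] at e
  calc ∫ x, g x • 𝓕 f x = ∫ x, ψ x • 𝓕 f x := by
        congr 1
    _ = ∫ x, (𝓕 ψ) x • f x := e2.symm
    _ = _ := e

theorem lintegral_sq_eq (f : ℝ → ℂ) : ∫⁻ x, (‖f x‖₊ : ℝ≥0∞) ^ 2 = (eLpNorm f 2 volume) ^ 2 := by
  rw [eLpNorm_eq_lintegral_rpow_enorm_toReal (by norm_num) (by norm_num)]
  rw [← ENNReal.rpow_natCast, ← ENNReal.rpow_mul]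
  simp [enorm_eq_nnnorm]

theorem plancherel_fourier (f : ℝ → ℂ) (h1 : Integrable f) (h2 : MemLp f 2) :
    ∫⁻ x, (‖𝓕 f x‖₊ : ℝ≥0∞) ^ 2 = ∫⁻ x, (‖f x‖₊ : ℝ≥0∞) ^ 2 := by
  rw [lintegral_sq_eq, lintegral_sq_eq, eLpNorm_congr_ae (plancherel_ae f h1 h2)]
  have h := Lp.norm_fourier_eq (h2.toLp f)
  rw [Lp.norm_def, Lp.norm_def, ENNReal.toReal_eq_toReal_iff' (Lp.eLpNorm_ne_top _)
    (Lp.eLpNorm_ne_top _)] at h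
  rw [h, eLpNorm_congr_ae h2.coeFn_toLp]

theorem plancherel_inv (f : ℝ → ℂ) (h1 : Integrable f) (h2 : MemLp f 2) :
    ∫⁻ x, (‖𝓕⁻ f x‖₊ : ℝ≥0∞) ^ 2 = ∫⁻ x, (‖f x‖₊ : ℝ≥0∞) ^ 2 := by
  rw [← plancherel_fourier f h1 h2]
  simp_rw [Real.fourierInv_eq_fourier_neg]
  exact lintegral_neg_eq_self (fun x => (‖𝓕 f x‖₊ : ℝ≥0∞) ^ 2)

theorem conv_eq (φ h : ℝ → ℂ) (hφ : Integrable φ) (hh : Integrable h) (ξ : ℝ) :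
    convF (𝓕⁻ φ) h ξ = 𝓕⁻ (fun x => φ x * 𝓕 h x) ξ := by
  have hm : Integrable (fun x : ℝ => (Real.fourierChar (x * ξ) : ℂ) * φ x) := by
    refine hφ.bdd_mul (c := 1) ?_ ?_
    · have : Continuous fun x : ℝ => (Real.fourierChar (x * ξ) : ℂ) :=
        continuous_subtype_val.comp (Real.continuous_fourierChar.comp (by fun_prop))
      exact this.aestronglyMeasurable
    · exact Eventually.of_forall fun x => (Circle.norm_coe (Real.fourierChar (x * ξ))).le
  have e2 := VectorFourier.integral_fourierIntegral_smul_eq_flip (L := innerₗ ℝ) (μ := volume) (ν := volume)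
    (f := fun x : ℝ => (Real.fourierChar (x * ξ) : ℂ) * φ x) (g := h)
      Real.continuous_fourierChar continuous_inner hm hh
  rw [flip_innerₗ] at e2
  have l : ∀ η, 𝓕⁻ φ (ξ - η) = VectorFourier.fourierIntegral Real.fourierChar volume (innerₗ ℝ)
      (fun x : ℝ => (Real.fourierChar (x * ξ) : ℂ) * φ x) η := by
    intro η
    rw [Real.fourierInv_eq, VectorFourier.fourierIntegral]
    congr 1
    ext x
    simp only [innerₗ_apply_apply, Circle.smul_def, smul_eq_mul, ← mul_assoc, ← Circle.coe_mul,
      ← AddChar.map_add_eq_mul]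
    congr 3
    simp
    ring
  unfold convF
  simp_rw [l]
  refine e2.trans ?_
  rw [Real.fourierInv_eq]
  congr 1
  ext x
  simp only [Circle.smul_def, smul_eq_mul]
  rw [mul_assoc]
  congr 3
  simp [mul_comm]

theorem tent_nonneg (k : ℤ) (x : ℝ) : 0 ≤ tent k x ∧ tent k x ≤ 1 := by
  have hk : (0 : ℝ) < 2 ^ k := by positivity
  have e1 : (2 : ℝ) ^ (1 - k) = 2 * (2 ^ k)⁻¹ := by
    rw [zpow_sub₀ (by norm_num)]; simp [div_eq_mul_inv]
  have e2 : (2 : ℝ) ^ (k - 1) = 2 ^ k / 2 := by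
    rw [zpow_sub₀ (by norm_num)]; simp
  have e3 : (2 : ℝ) ^ (k + 1) = 2 ^ k * 2 := by
    rw [zpow_add₀ (by norm_num)]; simp
  have e4 : (2 : ℝ) ^ (-k) = (2 ^ k)⁻¹ := by rw [zpow_neg]
  unfold tent
  rw [e1, e2, e3, e4]
  generalize (2 : ℝ) ^ k = a at *
  have hai : a⁻¹ * a = 1 := inv_mul_cancel₀ hk.ne'
  have hi : 0 < a⁻¹ := by positivity
  split_ifs with h1 h2 h3
  · norm_num
  · have := mul_le_mul_of_nonneg_left h2.1 hi.le
    have := mul_le_mul_of_nonneg_left h2.2 hi.le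
    constructor <;> nlinarith
  · have := mul_le_mul_of_nonneg_left h3.1 hi.le
    have := mul_le_mul_of_nonneg_left h3.2 hi.le
    constructor <;> nlinarith
  · norm_num

theorem tent_supp (k : ℤ) (x : ℝ) (h : tent k x ≠ 0) :
    (2 : ℝ) ^ (k - 1) ≤ x ∧ x ≤ 3 * 2 ^ k := by
  have hk : (0 : ℝ) < 2 ^ k := by positivity
  have e2 : (2 : ℝ) ^ (k - 1) = 2 ^ k / 2 := by
    rw [zpow_sub₀ (by norm_num)]; simp
  have e3 : (2 : ℝ) ^ (k + 1) = 2 ^ k * 2 := by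
    rw [zpow_add₀ (by norm_num)]; simp
  unfold tent at h
  rw [e2]
  rw [e2, e3] at h
  split_ifs at h with h1 h2 h3
  · exact ⟨by linarith [h1.1], by linarith [h1.2]⟩
  · exact ⟨by linarith [h2.1], by linarith [h2.2]⟩
  · exact ⟨by linarith [h3.1], by linarith [h3.2]⟩
  · exact absurd rfl h

theorem tent_measurable (k : ℤ) : Measurable (tent k) := by
  unfold tent
  refine Measurable.ite measurableSet_Icc measurable_const
    (Measurable.ite measurableSet_Icc (by fun_prop)
      (Measurable.ite measurableSet_Icc (by fun_prop) measurable_const))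

theorem tent_sum (x : ℝ) : ∑' k : ℤ, (‖(tent k x : ℂ)‖₊ : ℝ≥0∞) ^ 2 ≤ 3 := by
  have hle : ∀ k : ℤ, (‖(tent k x : ℂ)‖₊ : ℝ≥0∞) ^ 2 ≤ 1 := by
    intro k
    have : ‖(tent k x : ℂ)‖₊ ≤ 1 := by
      rw [← NNReal.coe_le_coe]
      simp [abs_of_nonneg (tent_nonneg k x).1, (tent_nonneg k x).2]
    exact pow_le_one₀ (by simp) (by exact_mod_cast this)
  by_cases hx : 0 < x
  · obtain ⟨n, hn⟩ := exists_mem_Ico_zpow hx (by norm_num : (1 : ℝ) < 2)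
    rw [tsum_eq_sum (s := {n - 1, n, n + 1})]
    · refine (Finset.sum_le_card_nsmul _ _ 1 (fun k _ => hle k)).trans ?_
      have : Finset.card ({n - 1, n, n + 1} : Finset ℤ) ≤ 3 := Finset.card_le_three
      simp only [nsmul_eq_mul, mul_one]
      exact_mod_cast this
    · intro k hk
      by_contra hne
      have ht : tent k x ≠ 0 := by
        intro h0; simp [h0] at hne
      obtain ⟨a, b⟩ := tent_supp k x ht
      have h1 : (2 : ℝ) ^ (k - 1) < 2 ^ (n + 1) := a.trans_lt hn.2
      have e4 : (2 : ℝ) ^ (k + 2) = 2 ^ k * 4 := by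
        rw [zpow_add₀ (by norm_num)]; norm_num
      have h2 : (2 : ℝ) ^ n < 2 ^ (k + 2) := by
        have : (0 : ℝ) < 2 ^ k := by positivity
        rw [e4]; linarith [hn.1]
      rw [zpow_lt_zpow_iff_right₀ (by norm_num)] at h1 h2
      simp at hk
      omega
  · have : ∀ k : ℤ, tent k x = 0 := by
      intro k
      by_contra h
      have := (tent_supp k x h).1
      have h0 : (0 : ℝ) < 2 ^ (k - 1) := by positivity
      linarith
    simp [this]

theorem sum_conv (h : ℝ → ℂ) (h1 : Integrable h) (h2 : MemLp h 2) :
    ∑' k : ℤ, ∫⁻ ξ, (‖convF (𝓕⁻ (fun x => (tent k x : ℂ))) h ξ‖₊ : ℝ≥0∞) ^ 2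
      ≤ 3 * ∫⁻ ξ, (‖h ξ‖₊ : ℝ≥0∞) ^ 2 := by
  have hcont : Continuous (𝓕 h) :=
    VectorFourier.fourierIntegral_continuous Real.continuous_fourierChar
      (L := innerₗ ℝ) continuous_inner h1
  have htm : ∀ k, Measurable (fun x => (tent k x : ℂ)) := fun k =>
    Complex.measurable_ofReal.comp (tent_measurable k)
  have htb : ∀ k x, ‖(tent k x : ℂ)‖ ≤ 1 := by
    intro k x
    simp [abs_of_nonneg (tent_nonneg k x).1, (tent_nonneg k x).2]
  have hsupp : ∀ (k : ℤ) x, x ∉ Icc ((2 : ℝ) ^ (k - 1)) (3 * 2 ^ k) → (tent k x : ℂ) = 0 := by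
    intro k x hx
    by_contra hne
    exact hx (tent_supp k x (by simpa using hne))
  have hcpt : ∀ k : ℤ, IntegrableOn (fun x => (tent k x : ℂ)) (Icc ((2 : ℝ) ^ (k - 1)) (3 * 2 ^ k)) := by
    intro k
    refine IntegrableOn.of_bound (C := 1) ?_ (htm k).aestronglyMeasurable
      (Eventually.of_forall (htb k))
    simp
  have hti : ∀ k, Integrable (fun x => (tent k x : ℂ)) := fun k =>
    (integrableOn_iff_integrable_of_support_subset (by
      intro x hx; by_contra hx'; exact hx (hsupp k x hx'))).1 (hcpt k)
  obtain ⟨M, hM⟩ : ∃ M, ∀ x, ‖𝓕 h x‖ ≤ M :=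
    ⟨_, fun x => VectorFourier.norm_fourierIntegral_le_integral_norm _ _ _ _ x⟩
  have hui : ∀ k, Integrable (fun x => (tent k x : ℂ) * 𝓕 h x) := fun k =>
    (hti k).mul_bdd hcont.aestronglyMeasurable (Eventually.of_forall hM)
  have hF2 : MemLp (𝓕 h) 2 := (memLp_congr_ae (plancherel_ae h h1 h2)).2 (Lp.memLp _)
  have hu2 : ∀ k, MemLp (fun x => (tent k x : ℂ) * 𝓕 h x) 2 := by
    intro k
    refine hF2.of_le ((htm k).aestronglyMeasurable.mul hcont.aestronglyMeasurable)
      (Eventually.of_forall fun x => ?_)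
    rw [norm_mul]
    exact mul_le_of_le_one_left (norm_nonneg _) (htb k x)
  calc _ = ∑' k : ℤ, ∫⁻ x, (‖(tent k x : ℂ)‖₊ : ℝ≥0∞) ^ 2 * (‖𝓕 h x‖₊ : ℝ≥0∞) ^ 2 := by
        congr 1
        ext k
        simp_rw [conv_eq _ h (hti k) h1]
        rw [plancherel_inv _ (hui k) (hu2 k)]
        simp [mul_pow]
    _ = ∫⁻ x, ∑' k : ℤ, (‖(tent k x : ℂ)‖₊ : ℝ≥0∞) ^ 2 * (‖𝓕 h x‖₊ : ℝ≥0∞) ^ 2 := by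
        rw [lintegral_tsum]
        intro k
        exact (((htm k).nnnorm.coe_nnreal_ennreal.pow_const 2).mul
          (hcont.measurable.nnnorm.coe_nnreal_ennreal.pow_const 2)).aemeasurable
    _ ≤ ∫⁻ x, 3 * (‖𝓕 h x‖₊ : ℝ≥0∞) ^ 2 := by
        refine lintegral_mono fun x => ?_
        simp only
        rw [ENNReal.tsum_mul_right]
        gcongr
        exact tent_sum x
    _ = _ := by
        rw [lintegral_const_mul _ (hcont.measurable.nnnorm.coe_nnreal_ennreal.pow_const 2),
          plancherel_fourier h h1 h2]

theorem mem_Iset_iff (n : ℤ) (x : ℝ) : x ∈ Iset n ↔ (2 : ℝ) ^ n ≤ |x| ∧ |x| ≤ 2 ^ (n + 1) := by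
  have h0 : (0 : ℝ) < 2 ^ n := by positivity
  unfold Iset
  simp only [mem_union, mem_Icc]
  rcases le_total 0 x with hx | hx
  · rw [abs_of_nonneg hx]
    constructor
    · rintro (h | h)
      · exact ⟨by linarith, by linarith⟩
      · exact h
    · exact fun h => Or.inr h
  · rw [abs_of_nonpos hx]
    constructor
    · rintro (h | h)
      · exact ⟨by linarith, by linarith⟩
      · exact ⟨by linarith, by linarith⟩
    · exact fun h => Or.inl ⟨by linarith, by linarith⟩

theorem Iset_meas (n : ℤ) : MeasurableSet (Iset n) := measurableSet_Icc.union measurableSet_Icc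

theorem Iset_aedisj : Pairwise (Function.onFun (AEDisjoint (volume : Measure ℝ)) Iset) := by
  have key : ∀ m n : ℤ, m < n → AEDisjoint (volume : Measure ℝ) (Iset m) (Iset n) := by
    intro m n hmn
    have : Iset m ∩ Iset n ⊆ {(2 : ℝ) ^ n, -(2 : ℝ) ^ n} := by
      rintro x ⟨h1, h2⟩
      rw [mem_Iset_iff] at h1 h2
      have : (2 : ℝ) ^ (m + 1) ≤ 2 ^ n := zpow_le_zpow_right₀ (by norm_num) (by omega)
      have hx : |x| = 2 ^ n := le_antisymm (h1.2.trans this) h2.1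
      exact eq_or_eq_neg_of_abs_eq hx
    exact measure_mono_null this ((Set.toFinite _).measure_zero _)
  intro m n hmn
  rcases lt_or_gt_of_ne hmn with h | h
  · exact key m n h
  · exact (key n m h).symm

theorem sum_Iset_le (F : ℝ → ℝ≥0∞) : ∑' m : ℤ, ∫⁻ x in Iset m, F x ≤ ∫⁻ x, F x := by
  rw [← lintegral_iUnion₀ (fun m => (Iset_meas m).nullMeasurableSet) Iset_aedisj]
  exact setLIntegral_le_lintegral _ _

theorem rpow_comp {x y c s : ℝ} (hx : 0 < x) (hy : 0 < y) (hc : 1 ≤ c) (h1 : x ≤ c * y)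
    (h2 : y ≤ c * x) (hs : |s| ≤ 1) : x ^ s ≤ c * y ^ s := by
  have hys : 0 < y ^ s := Real.rpow_pos_of_pos hy s
  rw [← div_le_iff₀ hys, ← Real.div_rpow hx.le hy.le]
  rcases le_total 0 s with h | h
  · rw [abs_of_nonneg h] at hs
    calc (x / y) ^ s ≤ c ^ s := Real.rpow_le_rpow (by positivity) ((div_le_iff₀ hy).2 h1) h
      _ ≤ c ^ (1 : ℝ) := Real.rpow_le_rpow_of_exponent_le hc hs
      _ = c := Real.rpow_one c
  · rw [abs_of_nonpos h] at hs
    calc (x / y) ^ s = (y / x) ^ (-s) := by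
          rw [Real.rpow_neg (by positivity), ← Real.inv_rpow (by positivity), inv_div]
      _ ≤ c ^ (-s) := Real.rpow_le_rpow (by positivity) ((div_le_iff₀ hx).2 h2) (by linarith)
      _ ≤ c ^ (1 : ℝ) := Real.rpow_le_rpow_of_exponent_le hc hs
      _ = c := Real.rpow_one c

theorem sq3 (a b c : ℂ) : (‖a + b + c‖₊ : ℝ≥0∞) ^ 2 ≤
    3 * ((‖a‖₊ : ℝ≥0∞) ^ 2 + (‖b‖₊ : ℝ≥0∞) ^ 2 + (‖c‖₊ : ℝ≥0∞) ^ 2) := by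
  have : ‖a + b + c‖₊ ^ 2 ≤ 3 * (‖a‖₊ ^ 2 + ‖b‖₊ ^ 2 + ‖c‖₊ ^ 2) := by
    rw [← NNReal.coe_le_coe]
    push_cast
    have h := norm_add₃_le (a := a) (b := b) (c := c)
    have h' := pow_le_pow_left₀ (norm_nonneg _) h 2
    nlinarith [sq_nonneg (‖a‖ - ‖b‖), sq_nonneg (‖a‖ - ‖c‖), sq_nonneg (‖b‖ - ‖c‖)]
  exact_mod_cast this

theorem piece (β : ℝ) (hβ : β ∈ Ioo (-(1 / 2) : ℝ) (1 / 2)) (g : ℝ → ℂ) (hg : Measurable g)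
    (hfin : (∫⁻ ξ : ℝ, (‖g ξ‖₊ : ℝ≥0∞) ^ 2 * ENNReal.ofReal (|ξ| ^ (2 * β))) < ⊤) (m : ℤ)
    (G : ℤ → ℝ≥0∞)
    (hG : ∀ n, G n = ∫⁻ ξ in Iset n, (‖g ξ‖₊ : ℝ≥0∞) ^ 2 * ENNReal.ofReal (|ξ| ^ (2 * β))) :
    ∑' (k : ℤ), ∫⁻ ξ in Iset m,
            (‖convF (𝓕⁻ (fun x => (tent k x : ℂ)))
                (fun x => (Iset (m - 1)).indicator g x + (Iset m).indicator g x +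
                  (Iset (m + 1)).indicator g x) ξ‖₊ : ℝ≥0∞) ^ 2 *
              ENNReal.ofReal (|ξ| ^ (2 * β))
      ≤ 72 * (G (m - 1) + G m + G (m + 1)) := by
  set h : ℝ → ℂ := fun x => (Iset (m - 1)).indicator g x + (Iset m).indicator g x +
                  (Iset (m + 1)).indicator g x with hh
  have hs : |2 * β| ≤ 1 := by rw [abs_le]; constructor <;> linarith [hβ.1, hβ.2]
  have ha : (0 : ℝ) < 2 ^ m := by positivity
  have e2 : (2 : ℝ) ^ (m - 1) = 2 ^ m / 2 := by
    rw [zpow_sub₀ (by norm_num)]; simp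
  have e3 : (2 : ℝ) ^ (m + 1) = 2 ^ m * 2 := by
    rw [zpow_add₀ (by norm_num)]; simp
  have e4 : (2 : ℝ) ^ (m + 1 + 1) = 2 ^ m * 4 := by
    rw [zpow_add₀ (by norm_num), e3]; ring
  set B : ℝ≥0∞ := ENNReal.ofReal (((2 : ℝ) ^ m) ^ (2 * β)) with hB
  have hB0 : B ≠ 0 := by
    simp only [hB, ne_eq, ENNReal.ofReal_eq_zero, not_le]; positivity
  have hBt : B ≠ ⊤ := ENNReal.ofReal_ne_top
  have w1 : ∀ ξ ∈ Iset m, ENNReal.ofReal (|ξ| ^ (2 * β)) ≤ 2 * B := by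
    intro ξ hξ
    rw [mem_Iset_iff, e3] at hξ
    rw [hB, show (2 : ℝ≥0∞) = ENNReal.ofReal 2 by simp, ← ENNReal.ofReal_mul (by norm_num)]
    exact ENNReal.ofReal_le_ofReal (rpow_comp (by linarith) ha (by norm_num) (by linarith)
      (by linarith) hs)
  have w2 : ∀ ξ : ℝ, 2 ^ m / 2 ≤ |ξ| → |ξ| ≤ 2 ^ m * 4 →
      B ≤ 4 * ENNReal.ofReal (|ξ| ^ (2 * β)) := by
    intro ξ h1 h2
    rw [hB, show (4 : ℝ≥0∞) = ENNReal.ofReal 4 by simp, ← ENNReal.ofReal_mul (by norm_num)]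
    exact ENNReal.ofReal_le_ofReal (rpow_comp ha (by linarith) (by norm_num) (by linarith)
      (by linarith) hs)
  have hgm : Measurable fun ξ => (‖g ξ‖₊ : ℝ≥0∞) ^ 2 := hg.nnnorm.coe_nnreal_ennreal.pow_const 2
  have hwm : Measurable fun ξ : ℝ => ENNReal.ofReal (|ξ| ^ (2 * β)) := by fun_prop
  have hn : ∀ n, (∀ ξ ∈ Iset n, (2 : ℝ) ^ m / 2 ≤ |ξ| ∧ |ξ| ≤ 2 ^ m * 4) →
      B * ∫⁻ ξ, (‖(Iset n).indicator g ξ‖₊ : ℝ≥0∞) ^ 2 ≤ 4 * G n := by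
    intro n hb
    have : ∀ ξ, (‖(Iset n).indicator g ξ‖₊ : ℝ≥0∞) ^ 2
        = (Iset n).indicator (fun ξ => (‖g ξ‖₊ : ℝ≥0∞) ^ 2) ξ := by
      intro ξ
      by_cases hξ : ξ ∈ Iset n <;> simp [hξ]
    simp_rw [this]
    rw [lintegral_indicator (Iset_meas n), ← lintegral_const_mul _ hgm, hG,
      ← lintegral_const_mul' _ _ (by simp)]
    refine setLIntegral_mono (by fun_prop) fun ξ hξ => ?_
    calc B * (‖g ξ‖₊ : ℝ≥0∞) ^ 2 ≤ (4 * ENNReal.ofReal (|ξ| ^ (2 * β))) * (‖g ξ‖₊ : ℝ≥0∞) ^ 2 := by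
          gcongr; exact w2 ξ (hb ξ hξ).1 (hb ξ hξ).2
      _ = _ := by ring
  have him : ∀ n, Measurable ((Iset n).indicator g) := fun n => hg.indicator (Iset_meas n)
  have him2 : ∀ n, Measurable fun ξ => (‖(Iset n).indicator g ξ‖₊ : ℝ≥0∞) ^ 2 := fun n =>
    (him n).nnnorm.coe_nnreal_ennreal.pow_const 2
  have hhm : Measurable h := ((him _).add (him _)).add (him _)
  have hH : B * ∫⁻ ξ, (‖h ξ‖₊ : ℝ≥0∞) ^ 2 ≤ 12 * (G (m - 1) + G m + G (m + 1)) := by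
    have b1 := hn (m - 1) (by
      intro ξ hξ; rw [mem_Iset_iff, sub_add_cancel, e2] at hξ
      exact ⟨by linarith, by linarith⟩)
    have b2 := hn m (by
      intro ξ hξ; rw [mem_Iset_iff, e3] at hξ
      exact ⟨by linarith, by linarith⟩)
    have b3 := hn (m + 1) (by
      intro ξ hξ; rw [mem_Iset_iff, e3, e4] at hξ
      exact ⟨by linarith, by linarith⟩)
    calc B * ∫⁻ ξ, (‖h ξ‖₊ : ℝ≥0∞) ^ 2
        ≤ B * ∫⁻ ξ, 3 * ((‖(Iset (m - 1)).indicator g ξ‖₊ : ℝ≥0∞) ^ 2 +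
          (‖(Iset m).indicator g ξ‖₊ : ℝ≥0∞) ^ 2 + (‖(Iset (m + 1)).indicator g ξ‖₊ : ℝ≥0∞) ^ 2) := by
          gcongr with ξ; exact sq3 _ _ _
      _ = 3 * (B * (∫⁻ ξ, (‖(Iset (m - 1)).indicator g ξ‖₊ : ℝ≥0∞) ^ 2) +
          B * (∫⁻ ξ, (‖(Iset m).indicator g ξ‖₊ : ℝ≥0∞) ^ 2) +
          B * ∫⁻ ξ, (‖(Iset (m + 1)).indicator g ξ‖₊ : ℝ≥0∞) ^ 2) := by
          rw [lintegral_const_mul' _ _ (by simp),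
            lintegral_add_right _ (him2 _), lintegral_add_right _ (him2 _)]
          ring
      _ ≤ 3 * (4 * G (m - 1) + 4 * G m + 4 * G (m + 1)) := by gcongr
      _ = _ := by ring
  have hGt : ∀ n, G n < ⊤ := fun n => by
    rw [hG]; exact (setLIntegral_le_lintegral _ _).trans_lt hfin
  have hHt : ∫⁻ ξ, (‖h ξ‖₊ : ℝ≥0∞) ^ 2 < ⊤ := by
    refine ENNReal.lt_top_of_mul_ne_top_right (a := B) ?_ hB0
    refine (hH.trans_lt ?_).ne
    exact ENNReal.mul_lt_top (by simp) (by simp [hGt])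
  have hL2 : MemLp h 2 := by
    refine ⟨hhm.aestronglyMeasurable, ?_⟩
    rw [lintegral_sq_eq] at hHt
    by_contra hc
    rw [not_lt, top_le_iff] at hc
    simp [hc] at hHt
  have hL1 : Integrable h := by
    rw [← memLp_one_iff_integrable]
    refine hL2.mono_exponent_of_measure_support_ne_top (s := Icc (-((2 : ℝ) ^ m * 4)) (2 ^ m * 4))
      ?_ (by simp) (by norm_num)
    intro x hx
    have hx' : ¬ (|x| ≤ 2 ^ m * 4) := fun hc => hx (abs_le.1 hc)
    have c1 : x ∉ Iset (m - 1) := by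
      rw [mem_Iset_iff, sub_add_cancel]; intro hc; apply hx'; linarith [hc.2]
    have c2 : x ∉ Iset m := by
      rw [mem_Iset_iff, e3]; intro hc; apply hx'; linarith [hc.2]
    have c3 : x ∉ Iset (m + 1) := by
      rw [mem_Iset_iff, e4]; intro hc; apply hx'; linarith [hc.2]
    simp [hh, c1, c2, c3]
  calc _ ≤ ∑' k : ℤ, 2 * B * ∫⁻ ξ, (‖convF (𝓕⁻ (fun x => (tent k x : ℂ))) h ξ‖₊ : ℝ≥0∞) ^ 2 := by
        refine ENNReal.tsum_le_tsum fun k => ?_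
        rw [← lintegral_const_mul' _ _ (ENNReal.mul_ne_top (by simp) hBt)]
        refine le_trans ?_ (setLIntegral_le_lintegral (Iset m) _)
        refine setLIntegral_mono' (Iset_meas m) fun ξ hξ => ?_
        rw [mul_comm]
        gcongr
        exact w1 ξ hξ
    _ = 2 * B * ∑' k : ℤ, ∫⁻ ξ, (‖convF (𝓕⁻ (fun x => (tent k x : ℂ))) h ξ‖₊ : ℝ≥0∞) ^ 2 :=
        ENNReal.tsum_mul_left
    _ ≤ 2 * B * (3 * ∫⁻ ξ, (‖h ξ‖₊ : ℝ≥0∞) ^ 2) := by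
        gcongr; exact sum_conv h hL1 hL2
    _ = 6 * (B * ∫⁻ ξ, (‖h ξ‖₊ : ℝ≥0∞) ^ 2) := by ring
    _ ≤ 6 * (12 * (G (m - 1) + G m + G (m + 1))) := by gcongr
    _ = _ := by ring

/-- The "diagonal" part `J₁` of the dyadic-tent decomposition:
`Σ_m Σ_k ∫_{I_m} |(φ_k^∨ * (g_{m-1}+g_m+g_{m+1}))(ξ)|² |ξ|^{2β} dξ ≤ C ∫ |g|² |ξ|^{2β} dξ`. -/
theorem stmt12 (β : ℝ) (hβ : β ∈ Ioo (-(1 / 2) : ℝ) (1 / 2)) :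
    ∃ C : ℝ, ∀ g : ℝ → ℂ, Measurable g →
      (∫⁻ ξ : ℝ, (‖g ξ‖₊ : ℝ≥0∞) ^ 2 * ENNReal.ofReal (|ξ| ^ (2 * β))) < ⊤ →
      ∑' (m : ℤ), ∑' (k : ℤ),
          ∫⁻ ξ in Iset m,
            (‖convF (𝓕⁻ (fun x => (tent k x : ℂ)))
                (fun x => (Iset (m - 1)).indicator g x + (Iset m).indicator g x +
                  (Iset (m + 1)).indicator g x) ξ‖₊ : ℝ≥0∞) ^ 2 *
              ENNReal.ofReal (|ξ| ^ (2 * β))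
        ≤ ENNReal.ofReal C *
            ∫⁻ ξ : ℝ, (‖g ξ‖₊ : ℝ≥0∞) ^ 2 * ENNReal.ofReal (|ξ| ^ (2 * β)) := by
  refine ⟨216, fun g hg hfin => ?_⟩
  set G : ℤ → ℝ≥0∞ := fun n =>
    ∫⁻ ξ in Iset n, (‖g ξ‖₊ : ℝ≥0∞) ^ 2 * ENNReal.ofReal (|ξ| ^ (2 * β)) with hG
  have hp := fun m => piece β hβ g hg hfin m G (fun n => rfl)
  refine (ENNReal.tsum_le_tsum hp).trans ?_
  rw [ENNReal.tsum_mul_left, ENNReal.tsum_add, ENNReal.tsum_add]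
  have s1 : ∑' m : ℤ, G (m - 1) = ∑' m, G m := (Equiv.subRight (1 : ℤ)).tsum_eq G
  have s2 : ∑' m : ℤ, G (m + 1) = ∑' m, G m := (Equiv.addRight (1 : ℤ)).tsum_eq G
  rw [s1, s2]
  have hle : ∑' m, G m ≤ ∫⁻ ξ : ℝ, (‖g ξ‖₊ : ℝ≥0∞) ^ 2 * ENNReal.ofReal (|ξ| ^ (2 * β)) :=
    sum_Iset_le _
  calc 72 * (∑' m, G m + ∑' m, G m + ∑' m, G m) = 216 * ∑' m, G m := by ring
    _ ≤ 216 * ∫⁻ ξ : ℝ, (‖g ξ‖₊ : ℝ≥0∞) ^ 2 * ENNReal.ofReal (|ξ| ^ (2 * β)) := by gcongr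
    _ = _ := by simp
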